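/- arXiv:1611.06819 — 2 statements merged into one kernel-verified Lean document; each statement's English description precedes it below -/
import Mathlib

section
/- Let k be a commutative ring and H a coquasi-bialgebra over k that is flat as a k-module. If S and T are both preantipodes for H, then S = T. -/
open scoped TensorProduct
open TensorProduct

/-- A coquasi-bialgebra structure on a coassociative counital `k`-coalgebra `H`:
a multiplication `mul` (a coalgebra morphism, given in curried bilinear form), a unit `one`,
and a convolution-invertible trilinear reassociator `ω` (with convolution inverse `ωInv`),
subject to the cocycle condition, unitality, and quasi-associativity.
Sweedler-type identities are stated for arbitrary finite representations of the
comultiplications involved. -/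
structure CoquasiBialgebra (k H : Type*) [CommRing k] [AddCommGroup H] [Module k H]
    [Coalgebra k H] where
  mul : H →ₗ[k] H →ₗ[k] H
  one : H
  ω : H →ₗ[k] H →ₗ[k] H →ₗ[k] k
  ωInv : H →ₗ[k] H →ₗ[k] H →ₗ[k] k
  /-- `mul` is comultiplicative: `Δ(xy) = ∑ x₁y₁ ⊗ x₂y₂`. -/
  comul_mul : ∀ (x y : H) (n m : ℕ) (x1 x2 : Fin n → H) (y1 y2 : Fin m → H),
    Coalgebra.comul (R := k) x = ∑ i, x1 i ⊗ₜ[k] x2 i →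
    Coalgebra.comul (R := k) y = ∑ j, y1 j ⊗ₜ[k] y2 j →
    Coalgebra.comul (R := k) (mul x y) =
      ∑ i, ∑ j, mul (x1 i) (y1 j) ⊗ₜ[k] mul (x2 i) (y2 j)
  counit_mul : ∀ x y, Coalgebra.counit (R := k) (mul x y) =
      Coalgebra.counit (R := k) x * Coalgebra.counit (R := k) y
  comul_one : Coalgebra.comul (R := k) one = one ⊗ₜ[k] one
  counit_one : Coalgebra.counit (R := k) one = 1
  one_mul : ∀ h, mul one h = h
  mul_one : ∀ h, mul h one = h
  /-- `ω(x ⊗ 1 ⊗ y) = ε(x)ε(y)`. -/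
  ω_one : ∀ x y, ω x one y = Coalgebra.counit (R := k) x * Coalgebra.counit (R := k) y
  /-- `ωInv` is the two-sided convolution inverse of `ω`. -/
  ω_conv_inv : ∀ (x y z : H) (n m p : ℕ) (x1 x2 : Fin n → H) (y1 y2 : Fin m → H)
    (z1 z2 : Fin p → H),
    Coalgebra.comul (R := k) x = ∑ i, x1 i ⊗ₜ[k] x2 i →
    Coalgebra.comul (R := k) y = ∑ j, y1 j ⊗ₜ[k] y2 j →
    Coalgebra.comul (R := k) z = ∑ l, z1 l ⊗ₜ[k] z2 l →
    (∑ i, ∑ j, ∑ l, ω (x1 i) (y1 j) (z1 l) * ωInv (x2 i) (y2 j) (z2 l) =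
      Coalgebra.counit (R := k) x * Coalgebra.counit (R := k) y *
        Coalgebra.counit (R := k) z) ∧
    (∑ i, ∑ j, ∑ l, ωInv (x1 i) (y1 j) (z1 l) * ω (x2 i) (y2 j) (z2 l) =
      Coalgebra.counit (R := k) x * Coalgebra.counit (R := k) y *
        Coalgebra.counit (R := k) z)
  /-- The 3-cocycle condition:
  `∑ ω(x₁ ⊗ y₁ ⊗ z₁w₁) ω(x₂y₂ ⊗ z₂ ⊗ w₂)
    = ∑ ω(y₁ ⊗ z₁ ⊗ w₁) ω(x₁ ⊗ y₂z₂ ⊗ w₂) ω(x₂ ⊗ y₃ ⊗ z₃)`. -/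
  cocycle : ∀ (x y z w : H) (nx ny nz nw : ℕ)
    (x1 x2 : Fin nx → H) (y1 y2 : Fin ny → H) (z1 z2 : Fin nz → H) (w1 w2 : Fin nw → H)
    (my : Fin ny → ℕ) (y21 y22 : ∀ j, Fin (my j) → H)
    (mz : Fin nz → ℕ) (z21 z22 : ∀ l, Fin (mz l) → H),
    Coalgebra.comul (R := k) x = ∑ i, x1 i ⊗ₜ[k] x2 i →
    Coalgebra.comul (R := k) y = ∑ j, y1 j ⊗ₜ[k] y2 j →
    Coalgebra.comul (R := k) z = ∑ l, z1 l ⊗ₜ[k] z2 l →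
    Coalgebra.comul (R := k) w = ∑ r, w1 r ⊗ₜ[k] w2 r →
    (∀ j, Coalgebra.comul (R := k) (y2 j) = ∑ p, y21 j p ⊗ₜ[k] y22 j p) →
    (∀ l, Coalgebra.comul (R := k) (z2 l) = ∑ q, z21 l q ⊗ₜ[k] z22 l q) →
    ∑ i, ∑ j, ∑ l, ∑ r,
        ω (x1 i) (y1 j) (mul (z1 l) (w1 r)) * ω (mul (x2 i) (y2 j)) (z2 l) (w2 r) =
      ∑ i, ∑ j, ∑ p, ∑ l, ∑ q, ∑ r,
        ω (y1 j) (z1 l) (w1 r) * ω (x1 i) (mul (y21 j p) (z21 l q)) (w2 r) *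
          ω (x2 i) (y22 j p) (z22 l q)
  /-- Quasi-associativity: `∑ x₁(y₁z₁) ω(x₂ ⊗ y₂ ⊗ z₂) = ∑ ω(x₁ ⊗ y₁ ⊗ z₁) (x₂y₂)z₂`. -/
  quasi_assoc : ∀ (x y z : H) (n m p : ℕ) (x1 x2 : Fin n → H) (y1 y2 : Fin m → H)
    (z1 z2 : Fin p → H),
    Coalgebra.comul (R := k) x = ∑ i, x1 i ⊗ₜ[k] x2 i →
    Coalgebra.comul (R := k) y = ∑ j, y1 j ⊗ₜ[k] y2 j →
    Coalgebra.comul (R := k) z = ∑ l, z1 l ⊗ₜ[k] z2 l →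
    ∑ i, ∑ j, ∑ l, ω (x2 i) (y2 j) (z2 l) • mul (x1 i) (mul (y1 j) (z1 l)) =
      ∑ i, ∑ j, ∑ l, ω (x1 i) (y1 j) (z1 l) • mul (mul (x2 i) (y2 j)) (z2 l)

/-- A preantipode for a coquasi-bialgebra: a `k`-linear endomorphism `S` with
(P1) `∑ S(h₁)₁h₂ ⊗ S(h₁)₂ = 1 ⊗ S(h)`, (P2) `∑ S(h₂)₁ ⊗ h₁S(h₂)₂ = S(h) ⊗ 1`,
(P3) `∑ ω(h₁ ⊗ S(h₂) ⊗ h₃) = ε(h)`. -/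
def CoquasiBialgebra.IsPreantipode {k H : Type*} [CommRing k] [AddCommGroup H] [Module k H]
    [Coalgebra k H] (B : CoquasiBialgebra k H) (S : H →ₗ[k] H) : Prop :=
  (∀ (h : H) (n : ℕ) (a b : Fin n → H) (m : Fin n → ℕ) (c d : ∀ i, Fin (m i) → H),
    Coalgebra.comul (R := k) h = ∑ i, a i ⊗ₜ[k] b i →
    (∀ i, Coalgebra.comul (R := k) (S (a i)) = ∑ p, c i p ⊗ₜ[k] d i p) →
    ∑ i, ∑ p, B.mul (c i p) (b i) ⊗ₜ[k] d i p = B.one ⊗ₜ[k] S h) ∧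
  (∀ (h : H) (n : ℕ) (a b : Fin n → H) (m : Fin n → ℕ) (c d : ∀ i, Fin (m i) → H),
    Coalgebra.comul (R := k) h = ∑ i, a i ⊗ₜ[k] b i →
    (∀ i, Coalgebra.comul (R := k) (S (b i)) = ∑ p, c i p ⊗ₜ[k] d i p) →
    ∑ i, ∑ p, c i p ⊗ₜ[k] B.mul (a i) (d i p) = S h ⊗ₜ[k] B.one) ∧
  (∀ (h : H) (n : ℕ) (a b : Fin n → H) (m : Fin n → ℕ) (c d : ∀ i, Fin (m i) → H),
    Coalgebra.comul (R := k) h = ∑ i, a i ⊗ₜ[k] b i →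
    (∀ i, Coalgebra.comul (R := k) (b i) = ∑ p, c i p ⊗ₜ[k] d i p) →
    ∑ i, ∑ p, B.ω (a i) (S (c i p)) (d i p) = Coalgebra.counit (R := k) h)

/-- `f` is `k`-linear; a `fun_prop` version of `IsLinearMap`. -/
@[fun_prop]
structure Lin (k : Type*) {M N : Type*} [CommRing k] [AddCommGroup M] [Module k M]
    [AddCommGroup N] [Module k N] (f : M → N) : Prop where
  isLinearMap : IsLinearMap k f

namespace Lin

variable {k M N P Q : Type*} [CommRing k] [AddCommGroup M] [Module k M] [AddCommGroup N]
  [Module k N] [AddCommGroup P] [Module k P] [AddCommGroup Q] [Module k Q]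

@[fun_prop]
theorem id' : Lin k (fun x : M => x) := ⟨⟨fun _ _ => rfl, fun _ _ => rfl⟩⟩

@[fun_prop]
theorem comp' {g : N → P} {f : M → N} (hg : Lin k g) (hf : Lin k f) :
    Lin k (fun x => g (f x)) :=
  ⟨(hg.1.mk' g ∘ₗ hf.1.mk' f).isLinear⟩

@[fun_prop]
theorem linearMap_apply (g : N →ₗ[k] P) {f : M → N} (hf : Lin k f) :
    Lin k (fun x => g (f x)) :=
  ⟨(g ∘ₗ hf.1.mk' f).isLinear⟩

@[fun_prop]
theorem linearMap_apply_left {g : M → N →ₗ[k] P} (hg : Lin k g) (y : N) :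
    Lin k (fun x => g x y) :=
  ⟨((hg.1.mk' g).flip y).isLinear⟩

@[fun_prop]
theorem mul_left {f : M → k} (hf : Lin k f) (c : k) : Lin k (fun x => f x * c) :=
  ⟨((LinearMap.mul k k).flip c ∘ₗ hf.1.mk' f).isLinear⟩

@[fun_prop]
theorem mul_right {f : M → k} (hf : Lin k f) (c : k) : Lin k (fun x => c * f x) :=
  ⟨(LinearMap.mul k k c ∘ₗ hf.1.mk' f).isLinear⟩

@[fun_prop]
theorem smul_left {f : M → k} (hf : Lin k f) (v : N) : Lin k (fun x => f x • v) :=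
  ⟨((LinearMap.lsmul k N).flip v ∘ₗ hf.1.mk' f).isLinear⟩

@[fun_prop]
theorem smul_right {f : M → N} (hf : Lin k f) (c : k) : Lin k (fun x => c • f x) :=
  ⟨(LinearMap.lsmul k N c ∘ₗ hf.1.mk' f).isLinear⟩

@[fun_prop]
theorem tmul_left {f : M → N} (hf : Lin k f) (v : P) : Lin k (fun x => f x ⊗ₜ[k] v) :=
  ⟨((TensorProduct.mk k N P).flip v ∘ₗ hf.1.mk' f).isLinear⟩

@[fun_prop]
theorem tmul_right {f : M → N} (hf : Lin k f) (v : P) : Lin k (fun x => v ⊗ₜ[k] f x) :=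
  ⟨(TensorProduct.mk k P N v ∘ₗ hf.1.mk' f).isLinear⟩

end Lin

section Sweedler

variable {k C D M N : Type*} [CommRing k] [AddCommGroup C] [Module k C] [AddCommGroup D]
  [Module k D] [AddCommGroup M] [Module k M] [AddCommGroup N] [Module k N]

theorem exists_lift₂ {f : C → D → M} (h₁ : ∀ y, Lin k (fun x => f x y))
    (h₂ : ∀ x, Lin k (f x)) : ∃ F : C ⊗[k] D →ₗ[k] M, ∀ x y, F (x ⊗ₜ y) = f x y :=
  ⟨TensorProduct.lift (LinearMap.mk₂ k f (fun _ _ y => (h₁ y).1.1 _ _)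
    (fun _ _ y => (h₁ y).1.2 _ _) (fun x => (h₂ x).1.1) (fun c x => (h₂ x).1.2 c)),
    fun _ _ => rfl⟩

theorem exists_lift₃ {f : C → C → C → M} (h₁ : ∀ y z, Lin k (fun x => f x y z))
    (h₂ : ∀ x z, Lin k (fun y => f x y z)) (h₃ : ∀ x y, Lin k (fun z => f x y z)) :
    ∃ F : C ⊗[k] (C ⊗[k] C) →ₗ[k] M, ∀ x y z, F (x ⊗ₜ (y ⊗ₜ z)) = f x y z := by
  choose G hG using fun x => exists_lift₂ (h₂ x) (h₃ x)
  have hG' : ∀ t, Lin k (fun x => G x t) := fun t => by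
    induction t with
    | zero => exact ⟨⟨by simp, by simp⟩⟩
    | tmul y z => simpa only [hG] using h₁ y z
    | add s t hs ht =>
      exact ⟨⟨fun x y => by simp only [map_add, hs.1.1, ht.1.1]; abel,
        fun c x => by simp only [map_add, hs.1.2, ht.1.2, smul_add]⟩⟩
  obtain ⟨F, hF⟩ := exists_lift₂ hG' (fun x => ⟨(G x).isLinear⟩)
  exact ⟨F, fun x y z => by rw [hF, hG]⟩

variable [Coalgebra k C] [Coalgebra k D]

/-- The Sweedler sum `∑ f(c₁, c₂)`, computed from a chosen representation of `Δ(c)`. -/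
noncomputable def sw (k : Type*) {C M : Type*} [CommRing k] [AddCommGroup C] [Module k C]
    [Coalgebra k C] [AddCommGroup M] (c : C) (f : C → C → M) : M :=
  ∑ i, f ((TensorProduct.exists_sum_tmul_eq (Coalgebra.comul (R := k) c)).choose_spec.choose i)
    ((TensorProduct.exists_sum_tmul_eq
      (Coalgebra.comul (R := k) c)).choose_spec.choose_spec.choose i)

theorem comul_eq_sw (c : C) : Coalgebra.comul (R := k) c = sw k c (fun x y => x ⊗ₜ[k] y) :=
  (TensorProduct.exists_sum_tmul_eq
    (Coalgebra.comul (R := k) c)).choose_spec.choose_spec.choose_spec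

theorem sw_congr {M : Type*} [AddCommGroup M] {c : C} {f g : C → C → M}
    (h : ∀ x y, f x y = g x y) :
    sw k c f = sw k c g := by
  rw [show f = g from funext fun x => funext (h x)]

theorem sw_comm {M : Type*} [AddCommGroup M] (c : C) (d : D) (f : C → C → D → D → M) :
    sw k c (fun x y => sw k d (f x y)) = sw k d (fun a b => sw k c (fun x y => f x y a b)) :=
  Finset.sum_comm

theorem map_sw {g : M → N} (hg : Lin k g) (c : C) (f : C → C → M) :
    g (sw k c f) = sw k c (fun x y => g (f x y)) :=
  map_sum (hg.1.mk' g) _ _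

theorem sw_smul (c : C) (f : C → C → k) (v : M) :
    sw k c f • v = sw k c (fun x y => f x y • v) :=
  map_sw (g := fun a : k => a • v) (by fun_prop) c f

theorem smul_sw (a : k) (c : C) (f : C → C → M) :
    a • sw k c f = sw k c (fun x y => a • f x y) :=
  map_sw (g := fun v : M => a • v) (by fun_prop) c f

theorem mul_sw (a : k) (c : C) (f : C → C → k) :
    a * sw k c f = sw k c (fun x y => a * f x y) :=
  smul_sw a c f

theorem sw_mul (c : C) (f : C → C → k) (a : k) :
    sw k c f * a = sw k c (fun x y => f x y * a) :=
  sw_smul c f a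

theorem sw_eq_lift {c : C} {f : C → C → M} {F : C ⊗[k] C →ₗ[k] M}
    (hF : ∀ x y, F (x ⊗ₜ y) = f x y) : sw k c f = F (Coalgebra.comul c) := by
  rw [comul_eq_sw, map_sw ⟨F.isLinear⟩]
  simp only [hF]

@[fun_prop]
theorem Lin.sw_right {c : C} {f : N → C → C → M} (h : ∀ x y, Lin k (fun t => f t x y)) :
    Lin k (fun t => sw k c (f t)) :=
  ⟨⟨fun x y => by simp only [sw, (h _ _).1.1, Finset.sum_add_distrib],
    fun r x => by simp only [sw, (h _ _).1.2, Finset.smul_sum]⟩⟩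

@[fun_prop]
theorem Lin.sw_left {g : N → C} {f : C → C → M} (h₁ : ∀ y, Lin k (fun x => f x y))
    (h₂ : ∀ x, Lin k (f x)) (hg : Lin k g) : Lin k (fun t => sw k (g t) f) := by
  obtain ⟨F, hF⟩ := exists_lift₂ h₁ h₂
  simp only [sw_eq_lift hF]
  fun_prop

theorem sw_counit_left (c : C) {f : C → M} (hf : Lin k f) :
    sw k c (fun x y => Coalgebra.counit (R := k) x • f y) = f c := by
  rw [sw_eq_lift (F := hf.1.mk' f ∘ₗ TensorProduct.lift (LinearMap.lsmul k C) ∘ₗ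
    Coalgebra.counit.rTensor C) (fun x y => by simp)]
  simp

theorem sw_counit_right (c : C) {f : C → M} (hf : Lin k f) :
    sw k c (fun x y => Coalgebra.counit (R := k) y • f x) = f c := by
  rw [sw_eq_lift (F := hf.1.mk' f ∘ₗ TensorProduct.lift (LinearMap.lsmul k C).flip ∘ₗ
    Coalgebra.counit.lTensor C) (fun x y => by simp)]
  simp

theorem sw_counit_mul (c : C) {f : C → k} (hf : Lin k f) :
    sw k c (fun x y => Coalgebra.counit (R := k) x * f y) = f c :=
  sw_counit_left c hf

theorem sw_mul_counit (c : C) {f : C → k} (hf : Lin k f) :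
    sw k c (fun x y => f x * Coalgebra.counit (R := k) y) = f c := by
  simpa only [mul_comm, smul_eq_mul] using sw_counit_right c hf

theorem sw_coassoc (c : C) {f : C → C → C → M} (h₁ : ∀ y z, Lin k (fun x => f x y z))
    (h₂ : ∀ x z, Lin k (fun y => f x y z)) (h₃ : ∀ x y, Lin k (fun z => f x y z)) :
    sw k c (fun x z => sw k x (fun a b => f a b z)) =
      sw k c (fun x y => sw k y (fun a b => f x a b)) := by
  obtain ⟨F, hF⟩ := exists_lift₃ h₁ h₂ h₃
  have := congrArg F (Coalgebra.coassoc_apply (R := k) c)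
  rw [sw_eq_lift (F := F ∘ₗ (TensorProduct.assoc k C C C).toLinearMap ∘ₗ
    Coalgebra.comul.rTensor C) fun x z => ?_, sw_eq_lift (F := F ∘ₗ Coalgebra.comul.lTensor C)
      fun x y => ?_]
  · exact this
  · rw [LinearMap.comp_apply, LinearMap.lTensor_tmul, comul_eq_sw,
      map_sw (g := fun t => F (x ⊗ₜ t)) (by fun_prop)]
    simp only [hF]
  · rw [LinearMap.comp_apply, LinearMap.comp_apply, LinearMap.rTensor_tmul, comul_eq_sw,
      map_sw (g := fun t => F ((TensorProduct.assoc k C C C).toLinearMap (t ⊗ₜ z)))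
        (by fun_prop)]
    simp [hF]

theorem sw_tmul (c : C) (d : D) {f : C ⊗[k] D → C ⊗[k] D → M}
    (h₁ : ∀ y, Lin k (fun x => f x y)) (h₂ : ∀ x, Lin k (f x)) :
    sw k (c ⊗ₜ[k] d) f =
      sw k c (fun c₁ c₂ => sw k d (fun d₁ d₂ => f (c₁ ⊗ₜ d₁) (c₂ ⊗ₜ d₂))) := by
  obtain ⟨F, hF⟩ := exists_lift₂ h₁ h₂
  simp only [sw_eq_lift hF, TensorProduct.comul_tmul, ← hF]
  rw [comul_eq_sw c, comul_eq_sw d]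
  let G := F ∘ₗ
    (TensorProduct.AlgebraTensorModule.tensorTensorTensorComm k k k k C C D D).toLinearMap
  change G (sw k c _ ⊗ₜ sw k d _) = _
  rw [map_sw (g := fun s => G (s ⊗ₜ _)) (by fun_prop)]
  refine sw_congr fun x y => ?_
  rw [map_sw (g := fun s => G (_ ⊗ₜ s)) (by fun_prop)]
  rfl

/-- Convolving with `φ` on the left cancels convolution with its right inverse `ω`. -/
theorem sw_cancel_left {φ ω : C →ₗ[k] k}
    (h : ∀ c, sw k c (fun x y => φ x * ω y) = Coalgebra.counit c) (c : C) {f : C → M}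
    (hf : Lin k f) : sw k c (fun x y => φ x • sw k y (fun a b => ω a • f b)) = f c := by
  simp only [smul_sw]
  rw [← sw_coassoc c (by fun_prop) (by fun_prop) (by fun_prop)]
  simp only [smul_smul, ← sw_smul, h]
  exact sw_counit_left c hf

/-- Convolving with `φ` on the right cancels convolution with its left inverse `ω`. -/
theorem sw_cancel_right {φ ω : C →ₗ[k] k}
    (h : ∀ c, sw k c (fun x y => ω x * φ y) = Coalgebra.counit c) (c : C) {f : C → M}
    (hf : Lin k f) : sw k c (fun x y => φ y • sw k x (fun a b => ω b • f a)) = f c := by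
  simp only [smul_sw]
  rw [sw_coassoc c (by fun_prop) (by fun_prop) (by fun_prop)]
  simp only [smul_smul, mul_comm (φ _), ← sw_smul, h]
  exact sw_counit_right c hf

end Sweedler

theorem Lin.ext_tmul {k C D M : Type*} [CommRing k] [AddCommGroup C] [Module k C]
    [AddCommGroup D] [Module k D] [AddCommGroup M] [Module k M] {f g : C ⊗[k] D → M}
    (hf : Lin k f) (hg : Lin k g) (h : ∀ x y, f (x ⊗ₜ y) = g (x ⊗ₜ y)) :
    ∀ t, f t = g t :=
  LinearMap.congr_fun (TensorProduct.ext' h : hf.1.mk' f = hg.1.mk' g)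

namespace CoquasiBialgebra

open Coalgebra

variable {k H M : Type*} [CommRing k] [AddCommGroup H] [Module k H] [Coalgebra k H]
  [AddCommGroup M] [Module k M] (B : CoquasiBialgebra k H)

theorem sw_one {f : H → H → M} (h₁ : ∀ y, Lin k (fun x => f x y)) (h₂ : ∀ x, Lin k (f x)) :
    sw k B.one f = f B.one B.one := by
  obtain ⟨F, hF⟩ := exists_lift₂ h₁ h₂
  rw [sw_eq_lift hF, B.comul_one, hF]

theorem sw_ω_mul_ωInv (x y z : H) :
    (sw k x fun x₁ x₂ => sw k y fun y₁ y₂ => sw k z fun z₁ z₂ =>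
      B.ω x₁ y₁ z₁ * B.ωInv x₂ y₂ z₂) =
      counit (R := k) x * counit (R := k) y * counit (R := k) z :=
  (B.ω_conv_inv x y z _ _ _ _ _ _ _ _ _ (comul_eq_sw x) (comul_eq_sw y) (comul_eq_sw z)).1

theorem sw_ωInv_mul_ω (x y z : H) :
    (sw k x fun x₁ x₂ => sw k y fun y₁ y₂ => sw k z fun z₁ z₂ =>
      B.ωInv x₁ y₁ z₁ * B.ω x₂ y₂ z₂) =
      counit (R := k) x * counit (R := k) y * counit (R := k) z :=
  (B.ω_conv_inv x y z _ _ _ _ _ _ _ _ _ (comul_eq_sw x) (comul_eq_sw y) (comul_eq_sw z)).2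

theorem sw_cocycle (x y z w : H) :
    (sw k x fun x₁ x₂ => sw k y fun y₁ y₂ => sw k z fun z₁ z₂ => sw k w fun w₁ w₂ =>
      B.ω x₁ y₁ (B.mul z₁ w₁) * B.ω (B.mul x₂ y₂) z₂ w₂) =
    sw k x fun x₁ x₂ => sw k y fun y₁ y' => sw k y' fun y₂ y₃ => sw k z fun z₁ z' =>
      sw k z' fun z₂ z₃ => sw k w fun w₁ w₂ =>
      B.ω y₁ z₁ w₁ * B.ω x₁ (B.mul y₂ z₂) w₂ * B.ω x₂ y₃ z₃ :=
  B.cocycle x y z w _ _ _ _ _ _ _ _ _ _ _ _ _ _ _ _ _ _ (comul_eq_sw x) (comul_eq_sw y)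
    (comul_eq_sw z) (comul_eq_sw w) (fun _ => comul_eq_sw _) (fun _ => comul_eq_sw _)

theorem sw_quasi_assoc (x y z : H) :
    (sw k x fun x₁ x₂ => sw k y fun y₁ y₂ => sw k z fun z₁ z₂ =>
      B.ω x₂ y₂ z₂ • B.mul x₁ (B.mul y₁ z₁)) =
    sw k x fun x₁ x₂ => sw k y fun y₁ y₂ => sw k z fun z₁ z₂ =>
      B.ω x₁ y₁ z₁ • B.mul (B.mul x₂ y₂) z₂ :=
  B.quasi_assoc x y z _ _ _ _ _ _ _ _ _ (comul_eq_sw x) (comul_eq_sw y) (comul_eq_sw z)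

theorem exists_reassociator : ∃ Ω Φ : H ⊗[k] (H ⊗[k] H) →ₗ[k] k,
    (∀ x y z, Ω (x ⊗ₜ (y ⊗ₜ z)) = B.ω x y z) ∧ (∀ x y z, Φ (x ⊗ₜ (y ⊗ₜ z)) = B.ωInv x y z) ∧
    (∀ c, sw k c (fun a b => Ω a * Φ b) = counit (R := k) c) ∧
    ∀ c, sw k c (fun a b => Φ a * Ω b) = counit (R := k) c := by
  obtain ⟨Ω, hΩ⟩ := exists_lift₃ (k := k) (f := fun x y z => B.ω x y z)
    (by fun_prop) (by fun_prop) (by fun_prop)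
  obtain ⟨Φ, hΦ⟩ := exists_lift₃ (k := k) (f := fun x y z => B.ωInv x y z)
    (by fun_prop) (by fun_prop) (by fun_prop)
  refine ⟨Ω, Φ, hΩ, hΦ, fun c => ?_, fun c => ?_⟩
  · revert c
    refine Lin.ext_tmul (by fun_prop) (by fun_prop) fun x t => ?_
    revert t
    refine Lin.ext_tmul (by fun_prop) (by fun_prop) fun y z => ?_
    simp (disch := fun_prop) only [sw_tmul, hΩ, hΦ, sw_ω_mul_ωInv]
    simp [mul_comm, mul_left_comm]
  · revert c
    refine Lin.ext_tmul (by fun_prop) (by fun_prop) fun x t => ?_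
    revert t
    refine Lin.ext_tmul (by fun_prop) (by fun_prop) fun y z => ?_
    simp (disch := fun_prop) only [sw_tmul, hΩ, hΦ, sw_ωInv_mul_ω]
    simp [mul_comm, mul_left_comm]

theorem ω_one_left (z w : H) :
    B.ω B.one z w = counit (R := k) z * counit (R := k) w := by
  obtain ⟨U, hU⟩ := exists_lift₂ (k := k) (f := fun z w => B.ω B.one z w)
    (by fun_prop) (by fun_prop)
  obtain ⟨V, hV⟩ := exists_lift₂ (k := k) (f := fun z w => B.ωInv B.one z w)
    (by fun_prop) (by fun_prop)
  have hVU : ∀ c, sw k c (fun a b => V a * U b) = counit (R := k) c := fun c => by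
    revert c
    refine Lin.ext_tmul (by fun_prop) (by fun_prop) fun z w => ?_
    have := B.sw_ωInv_mul_ω B.one z w
    rw [B.sw_one (by fun_prop) (by fun_prop)] at this
    simp (disch := fun_prop) only [sw_tmul, hU, hV, this]
    simp [B.counit_one, mul_comm]
  have hUU : ∀ c, sw k c (fun a b => U a * U b) = U c := fun c => by
    revert c
    refine Lin.ext_tmul (by fun_prop) (by fun_prop) fun z w => ?_
    have := B.sw_cocycle B.one B.one z w
    simp (disch := fun_prop) only [B.sw_one] at this
    simp only [B.ω_one, B.one_mul, B.counit_one, B.counit_mul, _root_.one_mul] at this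
    simp (disch := fun_prop) only [sw_tmul, hU]
    simp (disch := fun_prop) only [mul_assoc, ← mul_sw, sw_counit_mul] at this
    simp (disch := fun_prop) only [← mul_assoc, ← sw_mul, sw_mul_counit] at this
    exact this.symm
  have := sw_cancel_left hVU (z ⊗ₜ w) (f := U) (by fun_prop)
  simp only [smul_eq_mul, hUU, hVU, hU] at this
  rw [← this]
  simp [mul_comm]

theorem sw_ωInv_cocycle (x y z w : H) :
    (sw k x fun x₁ x₂ => sw k y fun y' y₃ => sw k z fun z' z₃ => sw k w fun w' w₃ =>
      sw k y' fun y₁ y₂ => sw k z' fun z₁ z₂ => sw k w' fun w₁ w₂ =>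
      B.ωInv y₁ z₁ w₁ * (B.ω x₁ y₂ (B.mul z₂ w₂) * B.ω (B.mul x₂ y₃) z₃ w₃)) =
    sw k x fun x₁ x₂ => sw k y fun y₁ y₂ => sw k z fun z₁ z₂ =>
      B.ω x₁ (B.mul y₁ z₁) w * B.ω x₂ y₂ z₂ := by
  obtain ⟨Ω, Φ, hΩ, hΦ, -, hΦΩ⟩ := B.exists_reassociator
  choose P hP using fun x => exists_lift₃ (k := k) (f := fun y z w => B.ω x y (B.mul z w))
    (by fun_prop) (by fun_prop) (by fun_prop)
  choose Q hQ using fun x => exists_lift₃ (k := k) (f := fun y z w => B.ω (B.mul x y) z w)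
    (by fun_prop) (by fun_prop) (by fun_prop)
  obtain ⟨R, hR⟩ := exists_lift₃ (k := k) (f := fun y z w =>
    sw k x fun x₁ x₂ => sw k y fun y₁ y₂ => sw k z fun z₁ z₂ =>
      B.ω x₁ (B.mul y₁ z₁) w * B.ω x₂ y₂ z₂) (by fun_prop) (by fun_prop) (by fun_prop)
  have hPQ : ∀ c, sw k c (fun a b => Ω a * R b) =
      sw k x fun x₁ x₂ => sw k c fun a b => P x₁ a * Q x₂ b := fun c => by
    revert c
    refine Lin.ext_tmul (by fun_prop) (by fun_prop) fun y t => ?_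
    revert t
    refine Lin.ext_tmul (by fun_prop) (by fun_prop) fun z w => ?_
    have h1 : ∀ x, Lin k (P x) := fun x => ⟨(P x).isLinear⟩
    have h2 : ∀ x, Lin k (Q x) := fun x => ⟨(Q x).isLinear⟩
    simp (disch := fun_prop) only [sw_tmul, hΩ, hP, hQ, hR]
    rw [sw_cocycle]
    simp only [mul_sw, mul_assoc]
    simp only [sw_comm w]
    simp only [sw_comm z]
    simp only [sw_comm y]
  rw [← hR, ← sw_cancel_left hΦΩ _ (f := R) (by fun_prop)]
  simp only [smul_eq_mul, hPQ, mul_sw]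
  clear hPQ hR R
  refine Eq.trans ?_ (sw_comm _ _ _)
  refine sw_congr fun x₁ x₂ => ?_
  have h1 : ∀ x, Lin k (P x) := fun x => ⟨(P x).isLinear⟩
  have h2 : ∀ x, Lin k (Q x) := fun x => ⟨(Q x).isLinear⟩
  rw [← sw_coassoc _ (by fun_prop) (by fun_prop) (by fun_prop)]
  simp (disch := fun_prop) only [sw_tmul, hΦ, hP, hQ]

theorem sw_ωInv_quasi_assoc (x y z : H) :
    (sw k x fun x₁ x₂ => sw k y fun y₁ y₂ => sw k z fun z₁ z₂ =>
      B.ωInv x₁ y₁ z₁ • B.mul x₂ (B.mul y₂ z₂)) =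
    sw k x fun x₁ x₂ => sw k y fun y₁ y₂ => sw k z fun z₁ z₂ =>
      B.ωInv x₂ y₂ z₂ • B.mul (B.mul x₁ y₁) z₁ := by
  obtain ⟨Ω, Φ, hΩ, hΦ, hΩΦ, hΦΩ⟩ := B.exists_reassociator
  obtain ⟨P, hP⟩ := exists_lift₃ (k := k) (f := fun x y z => B.mul x (B.mul y z))
    (by fun_prop) (by fun_prop) (by fun_prop)
  obtain ⟨Q, hQ⟩ := exists_lift₃ (k := k) (f := fun x y z => B.mul (B.mul x y) z)
    (by fun_prop) (by fun_prop) (by fun_prop)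
  have hPQ : ∀ c, sw k c (fun a b => Ω b • P a) = sw k c fun a b => Ω a • Q b := by
    refine Lin.ext_tmul (by fun_prop) (by fun_prop) fun x t => ?_
    revert t
    refine Lin.ext_tmul (by fun_prop) (by fun_prop) fun y z => ?_
    simp (disch := fun_prop) only [sw_tmul, hΩ, hP, hQ]
    exact B.sw_quasi_assoc x y z
  have key : ∀ c, sw k c (fun a b => Φ a • P b) = sw k c fun a b => Φ b • Q a := fun c => by
    calc
      _ = sw k c fun a b => Φ a • sw k b fun u v => Φ v • sw k u fun s t => Ω s • Q t := by
        simp only [← hPQ]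
        simp (disch := fun_prop) only [sw_cancel_right hΩΦ]
      _ = sw k c fun a b => Φ b • sw k a fun u v => Φ u • sw k v fun s t => Ω s • Q t := by
        simp only [smul_sw (M := H) (Φ _)]
        rw [← sw_coassoc c (by fun_prop) (by fun_prop) (by fun_prop)]
        simp only [smul_smul, mul_comm, mul_left_comm]
      _ = _ := by
        simp (disch := fun_prop) only [sw_cancel_left hΦΩ]
  have := key (x ⊗ₜ (y ⊗ₜ z))
  simpa (disch := fun_prop) only [sw_tmul, hΦ, hP, hQ] using this

theorem ω_one_right (x y : H) :
    B.ω x y B.one = counit (R := k) x * counit (R := k) y := by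
  obtain ⟨U, hU⟩ := exists_lift₂ (k := k) (f := fun x y => B.ω x y B.one)
    (by fun_prop) (by fun_prop)
  obtain ⟨V, hV⟩ := exists_lift₂ (k := k) (f := fun x y => B.ωInv x y B.one)
    (by fun_prop) (by fun_prop)
  have hVU : ∀ c, sw k c (fun a b => V a * U b) = counit (R := k) c := by
    refine Lin.ext_tmul (by fun_prop) (by fun_prop) fun x y => ?_
    have := B.sw_ωInv_mul_ω x y B.one
    simp (disch := fun_prop) only [B.sw_one] at this
    simp (disch := fun_prop) only [sw_tmul, hU, hV, this]
    simp [B.counit_one, mul_comm]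
  have hUU : ∀ c, sw k c (fun a b => U a * U b) = U c := by
    refine Lin.ext_tmul (by fun_prop) (by fun_prop) fun x y => ?_
    have := B.sw_cocycle x y B.one B.one
    simp (disch := fun_prop) only [B.sw_one] at this
    simp only [B.ω_one, B.mul_one, B.counit_one, B.counit_mul, _root_.mul_one] at this
    simp (disch := fun_prop) only [← mul_assoc, sw_mul_counit] at this
    simp (disch := fun_prop) only [mul_assoc, ← mul_sw, sw_counit_mul] at this
    simp (disch := fun_prop) only [sw_tmul, hU]
    exact this.symm
  have := sw_cancel_left hVU (x ⊗ₜ y) (f := U) (by fun_prop)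
  simp only [smul_eq_mul, hUU, hVU, hU] at this
  rw [← this]
  simp [mul_comm]

theorem sw_cocycle_coassoc (x y z w : H) :
    (sw k x fun x₁ x₂ => sw k y fun y₁ y₂ => sw k z fun z₁ z₂ => sw k w fun w₁ w₂ =>
      B.ω x₁ y₁ (B.mul z₁ w₁) * B.ω (B.mul x₂ y₂) z₂ w₂) =
    sw k x fun x₁ x₂ => sw k y fun y' y₃ => sw k z fun z' z₃ => sw k w fun w₁ w₂ =>
      sw k y' fun y₁ y₂ => sw k z' fun z₁ z₂ =>
      B.ω x₂ y₃ z₃ * (B.ω y₁ z₁ w₁ * B.ω x₁ (B.mul y₂ z₂) w₂) := by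
  rw [sw_cocycle]
  refine sw_congr fun x₁ x₂ => ?_
  rw [← sw_coassoc y (by fun_prop) (by fun_prop) (by fun_prop)]
  refine sw_congr fun y' y₃ => ?_
  simp only [sw_comm w]
  rw [sw_comm y']
  simp only [sw_comm y']
  rw [← sw_coassoc z (by fun_prop) (by fun_prop) (by fun_prop)]
  simp only [mul_comm]

theorem sw_cocycle_ωInv (x y z w : H) :
    (sw k w fun w₁ w₂ => sw k x fun x₁ x' => sw k y fun y₁ y' => sw k z fun z₁ z' =>
      sw k x' fun x₂ x₃ => sw k y' fun y₂ y₃ => sw k z' fun z₂ z₃ =>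
      B.ωInv x₃ y₃ z₃ * (B.ω x₁ y₁ (B.mul z₁ w₁) * B.ω (B.mul x₂ y₂) z₂ w₂)) =
    sw k w fun w₁ w₂ => sw k y fun y₁ y₂ => sw k z fun z₁ z₂ =>
      B.ω y₁ z₁ w₁ * B.ω x (B.mul y₂ z₂) w₂ := by
  obtain ⟨Ω, Φ, hΩ, hΦ, hΩΦ, -⟩ := B.exists_reassociator
  choose P hP using fun w => exists_lift₃ (k := k) (f := fun x y z => B.ω x y (B.mul z w))
    (by fun_prop) (by fun_prop) (by fun_prop)
  choose Q hQ using fun w => exists_lift₃ (k := k) (f := fun x y z => B.ω (B.mul x y) z w)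
    (by fun_prop) (by fun_prop) (by fun_prop)
  obtain ⟨R, hR⟩ := exists_lift₃ (k := k) (f := fun x y z =>
    sw k w fun w₁ w₂ => sw k y fun y₁ y₂ => sw k z fun z₁ z₂ =>
      B.ω y₁ z₁ w₁ * B.ω x (B.mul y₂ z₂) w₂) (by fun_prop) (by fun_prop) (by fun_prop)
  have hPQ : ∀ c, sw k c (fun a b => Ω b * R a) =
      sw k w fun w₁ w₂ => sw k c fun a b => P w₁ a * Q w₂ b := by
    refine Lin.ext_tmul (by fun_prop) (by fun_prop) fun x t => ?_
    revert t
    refine Lin.ext_tmul (by fun_prop) (by fun_prop) fun y z => ?_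
    simp (disch := fun_prop) only [sw_tmul, hΩ, hP, hQ, hR]
    have := B.sw_cocycle_coassoc x y z w
    simp only [sw_comm w, mul_sw] at this ⊢
    exact this.symm
  rw [← hR, ← sw_cancel_right hΩΦ _ (f := R) (by fun_prop)]
  simp only [smul_eq_mul, hPQ, mul_sw]
  clear hPQ hR R
  refine Eq.trans ?_ (sw_comm _ _ _)
  refine sw_congr fun w₁ w₂ => ?_
  rw [sw_coassoc _ (by fun_prop) (by fun_prop) (by fun_prop)]
  simp (disch := fun_prop) only [sw_tmul, hΦ, hP, hQ]

end CoquasiBialgebra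

namespace CoquasiBialgebra.IsPreantipode

open Coalgebra

variable {k H M : Type*} [CommRing k] [AddCommGroup H] [Module k H] [Coalgebra k H]
  [AddCommGroup M] [Module k M] {B : CoquasiBialgebra k H} {S T : H →ₗ[k] H}

theorem sw_mul_right (hS : B.IsPreantipode S) (h : H) {f : H → H → M}
    (h₁ : ∀ y, Lin k (fun x => f x y))
    (h₂ : ∀ x, Lin k (f x)) :
    (sw k h fun x y => sw k (S x) fun s t => f (B.mul s y) t) = f B.one (S h) := by
  obtain ⟨F, hF⟩ := exists_lift₂ h₁ h₂
  have := congrArg F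
    (hS.1 h _ _ _ _ _ _ (comul_eq_sw h) (fun _ => comul_eq_sw _))
  simp only [map_sum, hF] at this
  exact this

theorem sw_mul_left (hS : B.IsPreantipode S) (h : H) {f : H → H → M}
    (h₁ : ∀ y, Lin k (fun x => f x y))
    (h₂ : ∀ x, Lin k (f x)) :
    (sw k h fun x y => sw k (S y) fun s t => f s (B.mul x t)) = f (S h) B.one := by
  obtain ⟨F, hF⟩ := exists_lift₂ h₁ h₂
  have := congrArg F
    (hS.2.1 h _ _ _ _ _ _ (comul_eq_sw h) (fun _ => comul_eq_sw _))
  simp only [map_sum, hF] at this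
  exact this

theorem sw_ω (hS : B.IsPreantipode S) (h : H) :
    (sw k h fun x r => sw k r fun a b => B.ω x (S a) b) = counit (R := k) h :=
  hS.2.2 h _ _ _ _ _ _ (comul_eq_sw h) (fun _ => comul_eq_sw _)

theorem sw_mul_right_comul (hS : B.IsPreantipode S) (h : H) {f : H → H → H → M}
    (h₁ : ∀ y z, Lin k (fun x => f x y z))
    (h₂ : ∀ x z, Lin k (fun y => f x y z)) (h₃ : ∀ x y, Lin k (fun z => f x y z)) :
    (sw k h fun x y => sw k (S x) fun s t => sw k y fun c d => f (B.mul s c) t d) =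
      sw k h fun x y => f B.one (S x) y := by
  simp only [sw_comm (S _)]
  rw [← sw_coassoc h (by fun_prop) (by fun_prop) (by fun_prop)]
  exact sw_congr fun r d => hS.sw_mul_right r (f := fun s t => f s t d) (by fun_prop) (by fun_prop)

theorem sw_mul_left_comul (hS : B.IsPreantipode S) (h : H) {f : H → H → H → M}
    (h₁ : ∀ y z, Lin k (fun x => f x y z))
    (h₂ : ∀ x z, Lin k (fun y => f x y z)) (h₃ : ∀ x y, Lin k (fun z => f x y z)) :
    (sw k h fun x y => sw k x fun a b => sw k (S y) fun s t => f a s (B.mul b t)) =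
      sw k h fun x y => f x (S y) B.one := by
  rw [sw_coassoc h (by fun_prop) (by fun_prop) (by fun_prop)]
  exact sw_congr fun a r => hS.sw_mul_left r (f := f a) (by fun_prop) (by fun_prop)

theorem sw_ωInv_mul_ω_left (hS : B.IsPreantipode S) (q w : H) :
    (sw k q fun p z => sw k p fun x y => sw k (S y) fun s₁ s₂ => sw k z fun z₁ z₂ =>
      sw k w fun w₁ w₂ => B.ωInv s₁ z₁ w₁ * B.ω x s₂ (B.mul z₂ w₂)) =
      counit (R := k) q * counit (R := k) w := by
  have key : (sw k q fun p z => sw k p fun x y => _) =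
      sw k q fun p z => sw k p fun x y => _ :=
    sw_congr fun p z => sw_congr fun x y => B.sw_ωInv_cocycle x (S y) z w
  refine Eq.trans ?_ (key.trans ?_)
  · refine sw_congr fun p z => ?_
    rw [hS.sw_mul_left_comul p (f := fun x₁ y' v => sw k z fun z' z₃ => sw k w fun w' w₃ =>
      sw k y' fun y₁ y₂ => sw k z' fun z₁ z₂ => sw k w' fun w₁ w₂ =>
      B.ωInv y₁ z₁ w₁ * (B.ω x₁ y₂ (B.mul z₂ w₂) * B.ω v z₃ w₃))
      (by fun_prop) (by fun_prop) (by fun_prop)]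
    refine sw_congr fun x y => ?_
    simp (disch := fun_prop) only [B.ω_one_left, ← mul_assoc, ← sw_mul, sw_mul_counit]
  · simp (disch := fun_prop) only [sw_coassoc]
    have mid : ∀ x a u, (sw k u fun b z => sw k (S b) fun y₁ y₂ => sw k z fun z₁ z₂ =>
        B.ω x (B.mul y₁ z₁) w * B.ω a y₂ z₂) =
        sw k u fun b z => B.ω x B.one w * B.ω a (S b) z := fun x a u =>
      hS.sw_mul_right_comul u (f := fun s t d => B.ω x s w * B.ω a t d)
        (by fun_prop) (by fun_prop) (by fun_prop)
    simp only [mid, B.ω_one, ← mul_sw, hS.sw_ω]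
    simp (disch := fun_prop) only [mul_assoc, sw_counit_mul]
    exact mul_comm _ _

theorem sw_ωInv_mul_ω_right (hT : B.IsPreantipode T) (q w : H) :
    (sw k q fun z p => sw k p fun y x => sw k (T y) fun t₁ t₂ => sw k z fun z₁ z₂ =>
      sw k w fun w₁ w₂ => B.ωInv w₂ z₂ t₂ * B.ω (B.mul w₁ z₁) t₁ x) =
      counit (R := k) q * counit (R := k) w := by
  have key : (sw k q fun z p => sw k p fun y x => _) =
      sw k q fun z p => sw k p fun y x => _ :=
    sw_congr fun z p => sw_congr fun y x => B.sw_cocycle_ωInv w z (T y) x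
  refine Eq.trans ?_ (key.trans ?_)
  · refine sw_congr fun z p => ?_
    have mid := hT.sw_mul_right_comul p (f := fun u t' x₂ => sw k w fun w₁ w' =>
      sw k z fun z₁ z' => sw k w' fun w₂ w₃ => sw k z' fun z₂ z₃ => sw k t' fun t₂ t₃ =>
      B.ωInv w₃ z₃ t₃ * (B.ω w₁ z₁ u * B.ω (B.mul w₂ z₂) t₂ x₂))
      (by fun_prop) (by fun_prop) (by fun_prop)
    have comm : ∀ a b c d : k, a * (b * c * d) = b * (c * (a * d)) := fun a b c d => by ring
    simp (disch := fun_prop) only [B.ω_one_right, comm, ← mul_sw, sw_counit_mul] at mid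
    refine Eq.trans ?_ (mid.symm.trans ?_)
    · refine sw_congr fun y x => ?_
      simp only [sw_comm z]
      exact sw_comm _ _ _
    · simp only [sw_comm (T _)]
  · simp (disch := fun_prop) only [← sw_coassoc]
    have mid : ∀ r' x₁ x₂, (sw k r' fun u y => sw k u fun z₁ z₂ => sw k (T y) fun t₁ t₂ =>
        B.ω z₁ t₁ x₁ * B.ω w (B.mul z₂ t₂) x₂) =
        sw k r' fun z y => B.ω z (T y) x₁ * B.ω w B.one x₂ := fun r' x₁ x₂ =>
      hT.sw_mul_left_comul r' (f := fun z t v => B.ω z t x₁ * B.ω w v x₂)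
        (by fun_prop) (by fun_prop) (by fun_prop)
    simp only [mid, B.ω_one, ← sw_mul]
    simp (disch := fun_prop) only [sw_coassoc, hT.sw_ω, mul_left_comm _ (counit w), ← mul_sw,
      sw_mul_counit]
    exact mul_comm _ _

theorem sw_ωInv_smul_left (hS : B.IsPreantipode S) (hT : B.IsPreantipode T) (h : H) :
    (sw k h fun x r => sw k r fun z y => sw k (T y) fun t₁ t₂ =>
      B.ωInv (S x) z t₂ • t₁) = T h := by
  have key : (sw k h fun q r => sw k (T r) fun t₁ t₂ => _ • t₁) =
      sw k h fun q r => sw k (T r) fun t₁ t₂ => _ • t₁ :=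
    sw_congr fun q r => sw_congr fun t₁ t₂ => congrArg (· • t₁) (hS.sw_ωInv_mul_ω_left q t₂)
  refine Eq.trans ?_ (key.trans ?_)
  · simp only [sw_smul]
    simp only [sw_comm (T _)]
    simp (disch := fun_prop) only [← sw_coassoc (T _)]
    rw [sw_coassoc h (by fun_prop) (by fun_prop) (by fun_prop)]
    refine sw_congr fun p u => ?_
    simp only [sw_comm u]
    have mid : ∀ x s₁ s₂, (sw k u fun z r => sw k z fun z₁ z₂ => sw k (T r) fun t' w₂ =>
        sw k t' fun t₁ w₁ => (B.ωInv s₁ z₁ w₁ * B.ω x s₂ (B.mul z₂ w₂)) • t₁) =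
        sw k u fun z r => sw k (T r) fun t₁ w₁ =>
          (B.ωInv s₁ z w₁ * B.ω x s₂ B.one) • t₁ := fun x s₁ s₂ =>
      hT.sw_mul_left_comul u (f := fun z t' v => sw k t' fun t₁ w₁ =>
        (B.ωInv s₁ z w₁ * B.ω x s₂ v) • t₁) (by fun_prop) (by fun_prop) (by fun_prop)
    have comm : ∀ (a b c : k) (v : H), (a * (b * c)) • v = b • c • a • v := fun a b c v => by
      simp only [smul_smul]; ring_nf
    simp (disch := fun_prop) only [mid, B.ω_one_right, comm, ← smul_sw, sw_counit_right,
      sw_counit_left]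
  · simp (disch := fun_prop) only [mul_smul, ← smul_sw, sw_counit_right, sw_counit_left]

theorem sw_ωInv_smul_right (hS : B.IsPreantipode S) (hT : B.IsPreantipode T) (h : H) :
    (sw k h fun r p => sw k r fun y z => sw k (S y) fun s₁ s₂ =>
      B.ωInv s₁ z (T p) • s₂) = S h := by
  have key : (sw k h fun l q => sw k (S l) fun s₁ s₂ => _ • s₂) =
      sw k h fun l q => sw k (S l) fun s₁ s₂ => _ • s₂ :=
    sw_congr fun l q => sw_congr fun s₁ s₂ => congrArg (· • s₂) (hT.sw_ωInv_mul_ω_right q s₁)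
  refine Eq.trans ?_ (key.trans ?_)
  · simp only [sw_smul]
    simp only [sw_comm (S _)]
    simp (disch := fun_prop) only [sw_coassoc (S _)]
    rw [← sw_coassoc h (by fun_prop) (by fun_prop) (by fun_prop)]
    refine sw_congr fun r p => ?_
    simp only [sw_comm r]
    have mid : ∀ x t₁ t₂, (sw k r fun l z => sw k z fun z₁ z₂ => sw k (S l) fun w₁ s' =>
        sw k s' fun w₂ s => (B.ωInv w₂ z₂ t₂ * B.ω (B.mul w₁ z₁) t₁ x) • s) =
        sw k r fun l z => sw k (S l) fun w₂ s =>
          (B.ωInv w₂ z t₂ * B.ω B.one t₁ x) • s := fun x t₁ t₂ =>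
      Eq.trans (sw_congr fun l z => sw_comm _ _ _) <|
      hS.sw_mul_right_comul r (f := fun v s' z => sw k s' fun w₂ s =>
        (B.ωInv w₂ z t₂ * B.ω v t₁ x) • s) (by fun_prop) (by fun_prop) (by fun_prop)
    have comm : ∀ (a b c : k) (v : H), (a * (b * c)) • v = c • b • a • v := fun a b c v => by
      simp only [smul_smul]; ring_nf
    simp (disch := fun_prop) only [mid, B.ω_one_left, comm, ← smul_sw, sw_counit_right,
      sw_counit_left]
  · simp (disch := fun_prop) only [mul_smul, ← smul_sw, sw_counit_right, sw_counit_left]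

theorem sw_ωInv_smul_comm (hS : B.IsPreantipode S) (hT : B.IsPreantipode T) (h : H) :
    (sw k h fun r p => sw k r fun y z => sw k (S y) fun s₁ s₂ =>
      B.ωInv s₁ z (T p) • s₂) =
    sw k h fun x r => sw k r fun z y => sw k (T y) fun t₁ t₂ => B.ωInv (S x) z t₂ • t₁ := by
  have key : (sw k h fun x r => sw k r fun z y => _) = sw k h fun x r => sw k r fun z y => _ :=
    sw_congr fun x r => sw_congr fun z y => B.sw_ωInv_quasi_assoc (S x) z (T y)
  refine Eq.trans ?_ (key.trans ?_)
  · rw [sw_coassoc h (by fun_prop) (by fun_prop) (by fun_prop)]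
    refine sw_congr fun x r => ?_
    simp only [sw_comm (S _)]
    rw [hT.sw_mul_left_comul r (f := fun z t v => sw k (S x) fun s₁ s₂ =>
      B.ωInv s₁ z t • B.mul s₂ v) (by fun_prop) (by fun_prop) (by fun_prop)]
    simp only [B.mul_one]
  · rw [← sw_coassoc h (by fun_prop) (by fun_prop) (by fun_prop)]
    rw [← sw_coassoc h (by fun_prop) (by fun_prop) (by fun_prop)]
    refine sw_congr fun r y => ?_
    rw [hS.sw_mul_right_comul r (f := fun u s z => sw k (T y) fun t₁ t₂ =>
      B.ωInv s z t₂ • B.mul u t₁) (by fun_prop) (by fun_prop) (by fun_prop)]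
    simp only [B.one_mul]

end CoquasiBialgebra.IsPreantipode

/-- A `k`-flat coquasi-bialgebra admits at most one preantipode. -/
theorem preantipode_unique {k H : Type*} [CommRing k]
    [AddCommGroup H] [Module k H] [Coalgebra k H] [Module.Flat k H]
    (B : CoquasiBialgebra k H) (S T : H →ₗ[k] H)
    (hS : B.IsPreantipode S) (hT : B.IsPreantipode T) :
    S = T :=
  LinearMap.ext fun h => (hS.sw_ωInv_smul_right hT h).symm.trans
    ((hS.sw_ωInv_smul_comm hT h).trans (hS.sw_ωInv_smul_left hT h))
end

section
/- Let k be a field and let H be a coquasi-Hopf algebra over k with coquasi-antipode (s, α, β). Then the convolution product S := β * s * α, i.e. the k-linear map S(h) = ∑ β(h₁) s(h₂) α(h₃), is a preantipode for the underlying coquasi-bialgebra H. -/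
open scoped TensorProduct
open TensorProduct

namespace CoalgebraEval

open Coalgebra (comul coassoc_apply)

section FinRepresentation

variable {k M N : Type*} [CommRing k] [AddCommGroup M] [Module k M] [AddCommGroup N] [Module k N]

theorem exists_fin_sum_tmul (t : M ⊗[k] N) :
    ∃ (n : ℕ) (a : Fin n → M) (b : Fin n → N), t = ∑ i, a i ⊗ₜ[k] b i := by
  obtain ⟨S, hS⟩ := TensorProduct.exists_finset t
  refine ⟨S.card, fun i => (S.equivFin.symm i).1.1, fun i => (S.equivFin.symm i).1.2, ?_⟩
  rw [hS, ← Finset.sum_coe_sort S, ← Equiv.sum_comp S.equivFin.symm]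

/-- A family of tensors indexed by a type admits a simultaneous choice of finite
representations. -/
theorem exists_fin_sum_tmul_family {ι : Type*} (t : ι → M ⊗[k] N) :
    ∃ (m : ι → ℕ) (c : ∀ i, Fin (m i) → M) (d : ∀ i, Fin (m i) → N),
      ∀ i, t i = ∑ p, c i p ⊗ₜ[k] d i p := by
  choose m c d h using fun i => exists_fin_sum_tmul (t i)
  exact ⟨m, c, d, h⟩

end FinRepresentation

section Contraction

variable {k H : Type*} [CommRing k] [AddCommGroup H] [Module k H] [Coalgebra k H]

/-- The endomorphism `h ↦ ∑ f(h₁) h₂`. -/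
noncomputable def evalLeft (f : H →ₗ[k] k) : H →ₗ[k] H :=
  (TensorProduct.lid k H).toLinearMap ∘ₗ f.rTensor H ∘ₗ comul

/-- The endomorphism `h ↦ ∑ h₁ f(h₂)`. -/
noncomputable def evalRight (f : H →ₗ[k] k) : H →ₗ[k] H :=
  (TensorProduct.rid k H).toLinearMap ∘ₗ f.lTensor H ∘ₗ comul

theorem evalLeft_eq_sum (f : H →ₗ[k] k) {h : H} {n : ℕ} {a b : Fin n → H}
    (hab : comul (R := k) h = ∑ i, a i ⊗ₜ[k] b i) :
    evalLeft f h = ∑ i, f (a i) • b i := by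
  simp [evalLeft, hab]

theorem evalRight_eq_sum (f : H →ₗ[k] k) {h : H} {n : ℕ} {a b : Fin n → H}
    (hab : comul (R := k) h = ∑ i, a i ⊗ₜ[k] b i) :
    evalRight f h = ∑ i, f (b i) • a i := by
  simp [evalRight, hab]

theorem sum_comul_tmul {h : H} {n : ℕ} {a b : Fin n → H}
    (hab : comul (R := k) h = ∑ i, a i ⊗ₜ[k] b i) :
    ∑ i, TensorProduct.assoc k H H H (comul (R := k) (a i) ⊗ₜ[k] b i) =
      ∑ i, a i ⊗ₜ[k] comul (R := k) (b i) := by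
  have := coassoc_apply (R := k) h
  simpa [hab] using this

theorem comul_evalLeft (f : H →ₗ[k] k) (h : H) :
    comul (R := k) (evalLeft f h) = (evalLeft f).rTensor H (comul (R := k) h) := by
  obtain ⟨n, a, b, hab⟩ := exists_fin_sum_tmul (comul (R := k) h)
  obtain ⟨m, c, d, hcd⟩ := exists_fin_sum_tmul_family fun i => comul (R := k) (a i)
  have := congrArg ((TensorProduct.lid k (H ⊗[k] H)).toLinearMap ∘ₗ f.rTensor (H ⊗[k] H))
    (sum_comul_tmul hab)
  rw [evalLeft_eq_sum f hab, hab]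
  simp only [map_sum, map_smul, LinearMap.rTensor_tmul, evalLeft_eq_sum f (hcd _)]
  simp [hcd, TensorProduct.sum_tmul] at this
  simp only [← this, TensorProduct.sum_tmul, TensorProduct.smul_tmul']

theorem comul_evalRight (f : H →ₗ[k] k) (h : H) :
    comul (R := k) (evalRight f h) = (evalRight f).lTensor H (comul (R := k) h) := by
  obtain ⟨n, a, b, hab⟩ := exists_fin_sum_tmul (comul (R := k) h)
  obtain ⟨m, c, d, hcd⟩ := exists_fin_sum_tmul_family fun i => comul (R := k) (b i)
  have := congrArg ((TensorProduct.rid k (H ⊗[k] H)).toLinearMap ∘ₗ f.lTensor (H ⊗[k] H) ∘ₗ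
    (TensorProduct.assoc k H H H).symm.toLinearMap) (sum_comul_tmul hab)
  rw [evalRight_eq_sum f hab, hab]
  simp only [map_sum, map_smul, LinearMap.lTensor_tmul, evalRight_eq_sum f (hcd _)]
  simp [hcd, TensorProduct.tmul_sum] at this
  simp [this, TensorProduct.tmul_sum]

theorem evalLeft_evalRight (f g : H →ₗ[k] k) (h : H) :
    evalLeft f (evalRight g h) = evalRight g (evalLeft f h) := by
  obtain ⟨n, a, b, hab⟩ := exists_fin_sum_tmul (comul (R := k) h)
  rw [evalRight_eq_sum g hab]
  simp [evalRight, comul_evalLeft, hab]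

theorem lTensor_evalLeft_comul (f : H →ₗ[k] k) (h : H) :
    (evalLeft f).lTensor H (comul (R := k) h) =
      (evalRight f).rTensor H (comul (R := k) h) := by
  obtain ⟨n, a, b, hab⟩ := exists_fin_sum_tmul (comul (R := k) h)
  have := congrArg (((TensorProduct.lid k H).toLinearMap ∘ₗ f.rTensor H).lTensor H)
    (sum_comul_tmul hab)
  obtain ⟨m, c, d, hcd⟩ := exists_fin_sum_tmul_family fun i => comul (R := k) (a i)
  simp [hcd, TensorProduct.sum_tmul] at this
  simp only [hab, map_sum, LinearMap.rTensor_tmul, evalRight_eq_sum f (hcd _)]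
  simpa [evalLeft, TensorProduct.sum_tmul, TensorProduct.smul_tmul] using this.symm

theorem comul_evalRight_evalLeft (f g : H →ₗ[k] k) (h : H) :
    comul (R := k) (evalRight g (evalLeft f h)) =
      TensorProduct.map (evalLeft f) (evalRight g) (comul (R := k) h) := by
  rw [comul_evalRight, comul_evalLeft, ← LinearMap.comp_apply,
    LinearMap.lTensor_comp_rTensor]

end Contraction

end CoalgebraEval

open CoalgebraEval

/-- Let `k` be a field and `H` a coquasi-Hopf algebra with coquasi-antipode
`(s, α, β)`.  Then `S := β * s * α`, i.e. the `k`-linear map with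
`S(h) = ∑ β(h₁) s(h₂) α(h₃)`, is a preantipode for the underlying coquasi-bialgebra. -/
theorem coquasiHopf_convolution_is_preantipode {k H : Type*} [Field k]
    [AddCommGroup H] [Module k H] [Coalgebra k H]
    (B : CoquasiBialgebra k H)
    (s : H →ₗ[k] H) (α β : H →ₗ[k] k)
    -- `s` is an anti-coalgebra morphism
    (hs_comul : ∀ (h : H) (n : ℕ) (a b : Fin n → H),
      Coalgebra.comul (R := k) h = ∑ i, a i ⊗ₜ[k] b i →
      Coalgebra.comul (R := k) (s h) = ∑ i, s (b i) ⊗ₜ[k] s (a i))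
    (hs_counit : ∀ h : H, Coalgebra.counit (R := k) (s h) = Coalgebra.counit (R := k) h)
    -- `∑ h₁ β(h₂) s(h₃) = β(h) 1`
    (hax1 : ∀ (h : H) (n : ℕ) (a b : Fin n → H) (m : Fin n → ℕ)
      (c d : ∀ i, Fin (m i) → H),
      Coalgebra.comul (R := k) h = ∑ i, a i ⊗ₜ[k] b i →
      (∀ i, Coalgebra.comul (R := k) (b i) = ∑ p, c i p ⊗ₜ[k] d i p) →
      ∑ i, ∑ p, β (c i p) • B.mul (a i) (s (d i p)) = β h • B.one)
    -- `∑ s(h₁) α(h₂) h₃ = α(h) 1`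
    (hax2 : ∀ (h : H) (n : ℕ) (a b : Fin n → H) (m : Fin n → ℕ)
      (c d : ∀ i, Fin (m i) → H),
      Coalgebra.comul (R := k) h = ∑ i, a i ⊗ₜ[k] b i →
      (∀ i, Coalgebra.comul (R := k) (b i) = ∑ p, c i p ⊗ₜ[k] d i p) →
      ∑ i, ∑ p, α (c i p) • B.mul (s (a i)) (d i p) = α h • B.one)
    -- `∑ ω(h₁ ⊗ β(h₂)s(h₃)α(h₄) ⊗ h₅) = ε(h)`
    (hax3 : ∀ (h : H) (n : ℕ) (a b : Fin n → H) (m : Fin n → ℕ)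
      (c d : ∀ i, Fin (m i) → H) (m2 : ∀ i, Fin (m i) → ℕ)
      (e e' : ∀ i p, Fin (m2 i p) → H) (m3 : ∀ i p, Fin (m2 i p) → ℕ)
      (u v : ∀ i p q, Fin (m3 i p q) → H),
      Coalgebra.comul (R := k) h = ∑ i, a i ⊗ₜ[k] b i →
      (∀ i, Coalgebra.comul (R := k) (b i) = ∑ p, c i p ⊗ₜ[k] d i p) →
      (∀ i p, Coalgebra.comul (R := k) (d i p) = ∑ q, e i p q ⊗ₜ[k] e' i p q) →
      (∀ i p q, Coalgebra.comul (R := k) (e' i p q) = ∑ r, u i p q r ⊗ₜ[k] v i p q r) →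
      ∑ i, ∑ p, ∑ q, ∑ r,
          β (c i p) * B.ω (a i) (s (e i p q)) (v i p q r) * α (u i p q r) =
        Coalgebra.counit (R := k) h)
    -- `∑ ω⁻¹(s(h₁) ⊗ α(h₂)h₃β(h₄) ⊗ s(h₅)) = ε(h)`
    (hax4 : ∀ (h : H) (n : ℕ) (a b : Fin n → H) (m : Fin n → ℕ)
      (c d : ∀ i, Fin (m i) → H) (m2 : ∀ i, Fin (m i) → ℕ)
      (e e' : ∀ i p, Fin (m2 i p) → H) (m3 : ∀ i p, Fin (m2 i p) → ℕ)
      (u v : ∀ i p q, Fin (m3 i p q) → H),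
      Coalgebra.comul (R := k) h = ∑ i, a i ⊗ₜ[k] b i →
      (∀ i, Coalgebra.comul (R := k) (b i) = ∑ p, c i p ⊗ₜ[k] d i p) →
      (∀ i p, Coalgebra.comul (R := k) (d i p) = ∑ q, e i p q ⊗ₜ[k] e' i p q) →
      (∀ i p q, Coalgebra.comul (R := k) (e' i p q) = ∑ r, u i p q r ⊗ₜ[k] v i p q r) →
      ∑ i, ∑ p, ∑ q, ∑ r,
          α (c i p) * B.ωInv (s (a i)) (e i p q) (s (v i p q r)) * β (u i p q r) =
        Coalgebra.counit (R := k) h)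
    -- `S` is the convolution product `β * s * α`
    (S : H →ₗ[k] H)
    (hSdef : ∀ (h : H) (n : ℕ) (a b : Fin n → H) (m : Fin n → ℕ)
      (c d : ∀ i, Fin (m i) → H),
      Coalgebra.comul (R := k) h = ∑ i, a i ⊗ₜ[k] b i →
      (∀ i, Coalgebra.comul (R := k) (b i) = ∑ p, c i p ⊗ₜ[k] d i p) →
      S h = ∑ i, ∑ p, (β (a i) * α (d i p)) • s (c i p)) :
    B.IsPreantipode S := by
  have hS : ∀ h, S h = s (evalRight α (evalLeft β h)) := by
    intro h
    obtain ⟨n, a, b, hab⟩ := exists_fin_sum_tmul (Coalgebra.comul (R := k) h)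
    obtain ⟨m, c, d, hcd⟩ := exists_fin_sum_tmul_family fun i => Coalgebra.comul (R := k) (b i)
    rw [hSdef h n a b m c d hab hcd, evalLeft_eq_sum β hab]
    simp [evalRight_eq_sum α (hcd _), Finset.smul_sum, mul_smul]
  have hcomul_S : ∀ h, Coalgebra.comul (R := k) (S h) =
      TensorProduct.map (s ∘ₗ evalRight α) (s ∘ₗ evalLeft β)
        (TensorProduct.comm k H H (Coalgebra.comul (R := k) h)) := by
    intro h
    obtain ⟨n, a, b, hab⟩ := exists_fin_sum_tmul (Coalgebra.comul (R := k) h)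
    have h' : Coalgebra.comul (R := k) (evalRight α (evalLeft β h)) =
        ∑ i, evalLeft β (a i) ⊗ₜ[k] evalRight α (b i) := by
      simp [comul_evalRight_evalLeft, hab]
    rw [hS, hs_comul _ n _ _ h', hab]
    simp
  have h_right : ∀ h, TensorProduct.lift B.mul
      ((s ∘ₗ evalRight α).rTensor H (Coalgebra.comul (R := k) h)) = α h • B.one := by
    intro h
    obtain ⟨n, a, b, hab⟩ := exists_fin_sum_tmul (Coalgebra.comul (R := k) h)
    obtain ⟨m, c, d, hcd⟩ := exists_fin_sum_tmul_family fun i => Coalgebra.comul (R := k) (b i)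
    rw [← hax2 h n a b m c d hab hcd, LinearMap.rTensor_comp_apply, ← lTensor_evalLeft_comul,
      hab]
    simp [evalLeft_eq_sum α (hcd _)]
  have h_left : ∀ h, TensorProduct.lift B.mul
      ((s ∘ₗ evalLeft β).lTensor H (Coalgebra.comul (R := k) h)) = β h • B.one := by
    intro h
    obtain ⟨n, a, b, hab⟩ := exists_fin_sum_tmul (Coalgebra.comul (R := k) h)
    obtain ⟨m, c, d, hcd⟩ := exists_fin_sum_tmul_family fun i => Coalgebra.comul (R := k) (b i)
    rw [← hax1 h n a b m c d hab hcd, hab]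
    simp [evalLeft_eq_sum β (hcd _)]
  refine ⟨fun h n a b m c d hab hcd => ?_, fun h n a b m c d hab hcd => ?_,
    fun h n a b m c d hab hcd => ?_⟩
  · obtain ⟨m', c', d', hcd'⟩ := exists_fin_sum_tmul_family fun i => Coalgebra.comul (R := k) (a i)
    have hcoassoc := congrArg ((TensorProduct.comm k H H).toLinearMap ∘ₗ TensorProduct.map
      (s ∘ₗ evalLeft β) (TensorProduct.lift B.mul ∘ₗ (s ∘ₗ evalRight α).rTensor H))
      (sum_comul_tmul hab)
    simp [hcd', TensorProduct.sum_tmul, h_right] at hcoassoc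
    calc ∑ i, ∑ p, B.mul (c i p) (b i) ⊗ₜ[k] d i p
        = ∑ i, (B.mul.flip (b i)).rTensor H (Coalgebra.comul (R := k) (S (a i))) := by simp [hcd]
      _ = B.one ⊗ₜ[k] S h := by
        rw [hS, ← evalLeft_evalRight, evalRight_eq_sum α hab]
        simp only [hcomul_S, hcd']
        simp [hcoassoc, TensorProduct.tmul_sum]
  · obtain ⟨m', c', d', hcd'⟩ := exists_fin_sum_tmul_family fun i => Coalgebra.comul (R := k) (b i)
    have hcoassoc := congrArg ((TensorProduct.comm k H H).toLinearMap ∘ₗ TensorProduct.map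
      (TensorProduct.lift B.mul ∘ₗ (s ∘ₗ evalLeft β).lTensor H) (s ∘ₗ evalRight α) ∘ₗ
      (TensorProduct.assoc k H H H).symm.toLinearMap)
      (sum_comul_tmul hab)
    simp [hcd', TensorProduct.tmul_sum, h_left] at hcoassoc
    calc ∑ i, ∑ p, c i p ⊗ₜ[k] B.mul (a i) (d i p)
        = ∑ i, (B.mul (a i)).lTensor H (Coalgebra.comul (R := k) (S (b i))) := by simp [hcd]
      _ = S h ⊗ₜ[k] B.one := by
        rw [hS, evalLeft_eq_sum β hab]
        simp only [hcomul_S, hcd']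
        simp [← hcoassoc, TensorProduct.sum_tmul, TensorProduct.smul_tmul]
  · obtain ⟨m2, e, e', he⟩ := exists_fin_sum_tmul_family
      fun x : Σ i, Fin (m i) => Coalgebra.comul (R := k) (d x.1 x.2)
    obtain ⟨m3, u, v, hu⟩ := exists_fin_sum_tmul_family
      fun x : Σ (y : Σ i, Fin (m i)), Fin (m2 y) => Coalgebra.comul (R := k) (e' x.1 x.2)
    rw [← hax3 h n a b m c d (fun i p => m2 ⟨i, p⟩) (fun i p => e ⟨i, p⟩) (fun i p => e' ⟨i, p⟩)
      (fun i p q => m3 ⟨⟨i, p⟩, q⟩) (fun i p q => u ⟨⟨i, p⟩, q⟩) (fun i p q => v ⟨⟨i, p⟩, q⟩)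
      hab hcd (fun i p => he ⟨i, p⟩) (fun i p q => hu ⟨⟨i, p⟩, q⟩)]
    refine Finset.sum_congr rfl fun i _ => ?_
    have hcontract : S.rTensor H (Coalgebra.comul (R := k) (b i)) =
        ∑ p, β (c i p) • TensorProduct.map s (evalLeft α) (Coalgebra.comul (R := k) (d i p)) := by
      have hS' : S = s ∘ₗ evalRight α ∘ₗ evalLeft β := LinearMap.ext hS
      rw [hS', LinearMap.rTensor_comp_apply, LinearMap.rTensor_comp_apply, ← comul_evalLeft,
        ← lTensor_evalLeft_comul, evalLeft_eq_sum β (hcd i), ← LinearMap.comp_apply,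
        LinearMap.rTensor_comp_lTensor]
      simp
    have hω := congrArg (TensorProduct.lift (B.ω (a i))) hcontract
    have hL : ∀ p q, evalLeft α (e' ⟨i, p⟩ q) =
        ∑ r, α (u ⟨⟨i, p⟩, q⟩ r) • v ⟨⟨i, p⟩, q⟩ r :=
      fun p q => evalLeft_eq_sum α (hu ⟨⟨i, p⟩, q⟩)
    simp only [hcd, he ⟨i, _⟩, map_sum, map_smul, LinearMap.rTensor_tmul,
      TensorProduct.map_tmul, TensorProduct.lift.tmul, hL, smul_eq_mul, Finset.mul_sum] at hω
    rw [hω]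
    simp only [mul_assoc, mul_comm (α _)]
end
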